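/- Let (a,b,c,d) ∈ ℂ⁴ with a·d − b·c = 1, and suppose all nine entries of C(!![a,b;c,d]) are Gaussian integers. Then a², b², c², d² all lie in ℚ(i); that is, each of a², b², c², d² has rational real part and rational imaginary part. -/

import Mathlib

open Complex Matrix

noncomputable section

/-- `z ∈ ℤ[i] ⊆ ℂ`. -/
def IsGauss (z : ℂ) : Prop := ∃ a b : ℤ, z = (a : ℂ) + (b : ℂ) * Complex.I

/-- `z ∈ ℚ(i) ⊆ ℂ`: rational real and imaginary parts. -/
def IsRatGauss (z : ℂ) : Prop := ∃ p q : ℚ, z = (p : ℂ) + (q : ℂ) * Complex.I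

/-- The matrix of the conjugation action of `g ∈ SL(2,ℂ)` on `sl₂(ℂ)` in the trace-form
orthonormal basis. -/
def CMat (g : Matrix (Fin 2) (Fin 2) ℂ) : Matrix (Fin 3) (Fin 3) ℂ :=
  !![(g 0 0 ^ 2 - g 1 0 ^ 2 + g 1 1 ^ 2 - g 0 1 ^ 2) / 2,
     Complex.I * (g 0 0 ^ 2 - g 1 0 ^ 2 + g 0 1 ^ 2 - g 1 1 ^ 2) / 2,
     g 1 0 * g 1 1 - g 0 0 * g 0 1;
     Complex.I * (g 0 1 ^ 2 + g 1 1 ^ 2 - g 0 0 ^ 2 - g 1 0 ^ 2) / 2,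
     (g 0 0 ^ 2 + g 1 0 ^ 2 + g 0 1 ^ 2 + g 1 1 ^ 2) / 2,
     Complex.I * (g 0 0 * g 0 1 + g 1 0 * g 1 1);
     -(g 0 0 * g 1 0) + g 0 1 * g 1 1,
     Complex.I * (g 0 0 * g 1 0 + g 0 1 * g 1 1),
     g 0 0 * g 1 1 + g 0 1 * g 1 0]

theorem IsGauss.add {z w : ℂ} (hz : IsGauss z) (hw : IsGauss w) : IsGauss (z + w) := by
  obtain ⟨p, q, rfl⟩ := hz
  obtain ⟨r, s, rfl⟩ := hw
  exact ⟨p + r, q + s, by push_cast; ring⟩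

theorem IsGauss.neg {z : ℂ} (hz : IsGauss z) : IsGauss (-z) := by
  obtain ⟨p, q, rfl⟩ := hz
  exact ⟨-p, -q, by push_cast; ring⟩

theorem IsGauss.I_mul {z : ℂ} (hz : IsGauss z) : IsGauss (I * z) := by
  obtain ⟨p, q, rfl⟩ := hz
  exact ⟨-q, p, by push_cast; linear_combination (q : ℂ) * I_sq⟩

theorem IsGauss.isRatGauss_half {z : ℂ} (hz : IsGauss z) : IsRatGauss (z / 2) := by
  obtain ⟨p, q, rfl⟩ := hz
  exact ⟨p / 2, q / 2, by push_cast; ring⟩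

/-- If `(a,b,c,d) ∈ ℂ⁴` with `a·d − b·c = 1` and all nine entries of `C(!![a,b;c,d])` are
Gaussian integers, then `a², b², c², d²` all lie in `ℚ(i)`. -/
theorem stmt6 (a b c d : ℂ) (hdet : a * d - b * c = 1)
    (hC : ∀ i j, IsGauss (CMat !![a, b; c, d] i j)) :
    IsRatGauss (a ^ 2) ∧ IsRatGauss (b ^ 2) ∧ IsRatGauss (c ^ 2) ∧ IsRatGauss (d ^ 2) := by
  have h00 := hC 0 0
  have h01 := (hC 0 1).I_mul
  have h10 := (hC 1 0).I_mul
  have h11 := hC 1 1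
  simp only [CMat, of_apply, cons_val', cons_val_zero, cons_val_one, cons_val_fin_one]
    at h00 h01 h10 h11
  refine ⟨?_, ?_, ?_, ?_⟩
  · convert ((h11.add h00).add (h10.add h01.neg)).isRatGauss_half using 1
    linear_combination (a ^ 2 - d ^ 2) / 2 * I_sq
  · convert ((h11.add h00.neg).add (h10.neg.add h01.neg)).isRatGauss_half using 1
    linear_combination (b ^ 2 - c ^ 2) / 2 * I_sq
  · convert ((h11.add h00.neg).add (h10.add h01)).isRatGauss_half using 1
    linear_combination (c ^ 2 - b ^ 2) / 2 * I_sq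
  · convert ((h11.add h00).add (h10.neg.add h01)).isRatGauss_half using 1
    linear_combination (d ^ 2 - a ^ 2) / 2 * I_sq
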